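/- If there exists an additive subgroup of F_q^{2n} defining a pure subsystem code with parameters ((n,K,R,d))_q with n ≥ 2 and d ≥ 2, then there exists an additive subgroup of F_q^{2(n−1)} defining a subsystem code with parameters ((n−1, K, qR, d'))_q with d' ≥ d−1. -/

import Mathlib

open Matrix
open scoped Classical

/-- The symplectic vector space `F_q^{2n}`: pairs `(x|y)` with `x, y ∈ F_q^n`. -/
abbrev SV (F : Type*) (n : ℕ) := (Fin n → F) × (Fin n → F)

/-- The symplectic weight `swt(x|y) = #{i : (x_i, y_i) ≠ (0,0)}`. -/
noncomputable def swt {F : Type*} [Zero F] {n : ℕ} (v : SV F n) : ℕ :=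
  Nat.card {i : Fin n // v.1 i ≠ 0 ∨ v.2 i ≠ 0}

/-- minimum symplectic weight of a nonzero element of a set -/
noncomputable def swtSet {F : Type*} [Zero F] {n : ℕ} (S : Set (SV F n)) : ℕ :=
  sInf (swt '' {v | v ∈ S ∧ v ≠ 0})

/-- The trace-symplectic form `⟨u|v⟩ₛ = Tr_{q/p}(v₁·u₂ − u₁·v₂)`. -/
noncomputable def trSymp (p : ℕ) {F : Type*} [Field F] [Fintype F] [CharP F p] {n : ℕ}
    (u v : SV F n) : ZMod p :=
  letI := ZMod.algebra F p
  Algebra.trace (ZMod p) F (dotProduct v.1 u.2 - dotProduct u.1 v.2)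

/-- The trace-symplectic dual of a subset of `F_q^{2n}`. -/
def sdual (p : ℕ) {F : Type*} [Field F] [Fintype F] [CharP F p] {n : ℕ}
    (S : Set (SV F n)) : Set (SV F n) :=
  {v | ∀ w ∈ S, trSymp p v w = 0}

/-- `C` defines a subsystem code with parameters `((n,K,R,d))_q`, where
`K = q^n/(|C||D|)^{1/2}`, `R = (|C|/|D|)^{1/2}` for `D = C ∩ C^⊥s`, and `d` is the
symplectic weight of `D^⊥s \ C` (resp. of `D^⊥s` if `D^⊥s = C`). -/
def IsSubsystemCode (p : ℕ) {F : Type*} [Field F] [Fintype F] [CharP F p] {n : ℕ}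
    (K R d : ℕ) (C : AddSubgroup (SV F n)) : Prop :=
  C ≠ ⊥ ∧
  K ^ 2 * (Nat.card C * Nat.card ↥((C : Set (SV F n)) ∩ sdual p (C : Set (SV F n)))) =
    Fintype.card F ^ (2 * n) ∧
  R ^ 2 * Nat.card ↥((C : Set (SV F n)) ∩ sdual p (C : Set (SV F n))) = Nat.card C ∧
  d = if sdual p ((C : Set (SV F n)) ∩ sdual p (C : Set (SV F n))) = (C : Set (SV F n))
      then swtSet (sdual p ((C : Set (SV F n)) ∩ sdual p (C : Set (SV F n))))
      else swtSet (sdual p ((C : Set (SV F n)) ∩ sdual p (C : Set (SV F n))) \ (C : Set (SV F n)))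

/-- The subsystem code defined by `C` is pure to `d'`, i.e. `swt(D^⊥s) ≥ d'`. -/
def PureTo (p : ℕ) {F : Type*} [Field F] [Fintype F] [CharP F p] {n : ℕ}
    (d' : ℕ) (C : AddSubgroup (SV F n)) : Prop :=
  d' ≤ swtSet (sdual p ((C : Set (SV F n)) ∩ sdual p (C : Set (SV F n))))

section Shortening

variable {p : ℕ} {F : Type*} [Field F] {n : ℕ}

/-- The first coordinate pair of `(x|y)`. -/
def headHom : SV F (n + 1) →+ F × F where
  toFun v := (v.1 0, v.2 0)
  map_zero' := rfl
  map_add' _ _ := rfl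

/-- Puncturing: `(x|y)` with the first coordinate pair removed. -/
def tailHom : SV F (n + 1) →+ SV F n where
  toFun v := (Fin.tail v.1, Fin.tail v.2)
  map_zero' := rfl
  map_add' _ _ := rfl

theorem headHom_apply (v : SV F (n + 1)) : headHom v = (v.1 0, v.2 0) := rfl

theorem tailHom_apply (v : SV F (n + 1)) : tailHom v = (Fin.tail v.1, Fin.tail v.2) := rfl

theorem exists_headHom_tailHom (a : F × F) (v : SV F n) :
    ∃ u : SV F (n + 1), headHom u = a ∧ tailHom u = v :=
  ⟨(Fin.cons a.1 v.1, Fin.cons a.2 v.2), by simp [headHom_apply], by simp [tailHom_apply]⟩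

theorem eq_of_headHom_eq_of_tailHom_eq {u v : SV F (n + 1)} (hh : headHom u = headHom v)
    (ht : tailHom u = tailHom v) : u = v := by
  simp only [headHom_apply, tailHom_apply, Prod.mk.injEq] at hh ht
  refine Prod.ext ?_ ?_
  · rw [← Fin.cons_self_tail u.1, ← Fin.cons_self_tail v.1, hh.1, ht.1]
  · rw [← Fin.cons_self_tail u.2, ← Fin.cons_self_tail v.2, hh.2, ht.2]

theorem swt_eq_card_filter (v : SV F n) :
    swt v = (Finset.univ.filter fun i => v.1 i ≠ 0 ∨ v.2 i ≠ 0).card := by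
  rw [swt, Nat.card_eq_fintype_card, Fintype.card_subtype]

theorem swt_le_swt_tailHom_add_one (v : SV F (n + 1)) : swt v ≤ swt (tailHom v) + 1 := by
  rw [swt_eq_card_filter, swt_eq_card_filter, Fin.card_filter_univ_succ]
  have : (Finset.univ.filter fun i : Fin n => v.1 i.succ ≠ 0 ∨ v.2 i.succ ≠ 0) =
      Finset.univ.filter fun i => (tailHom v).1 i ≠ 0 ∨ (tailHom v).2 i ≠ 0 := rfl
  split_ifs
  · exact (congrArg (fun s => Finset.card s + 1) this).le
  · exact (congrArg Finset.card this).le.trans (Nat.le_succ _)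

theorem swtSet_le {S : Set (SV F n)} {v : SV F n} (hv : v ∈ S) (h0 : v ≠ 0) :
    swtSet S ≤ swt v :=
  Nat.sInf_le ⟨v, ⟨hv, h0⟩, rfl⟩

theorem le_swtSet {S : Set (SV F n)} {d : ℕ} (hne : ∃ v ∈ S, v ≠ 0)
    (h : ∀ v ∈ S, v ≠ 0 → d ≤ swt v) : d ≤ swtSet S := by
  obtain ⟨v, hv, h0⟩ := hne
  refine le_csInf ⟨_, v, ⟨hv, h0⟩, rfl⟩ ?_
  rintro _ ⟨w, ⟨hw, hw0⟩, rfl⟩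
  exact h w hw hw0

variable [Fintype F] [CharP F p]

/-- The trace-symplectic form on a single coordinate pair. -/
noncomputable def trPair (p : ℕ) {F : Type*} [Field F] [Fintype F] [CharP F p] (a b : F × F) :
    ZMod p :=
  letI := ZMod.algebra F p
  Algebra.trace (ZMod p) F (b.1 * a.2 - a.1 * b.2)

theorem trPair_zero_left (b : F × F) : trPair p 0 b = 0 := by
  simp [trPair]

theorem trSymp_eq_trPair_add (u v : SV F (n + 1)) :
    trSymp p u v = trPair p (headHom u) (headHom v) + trSymp p (tailHom u) (tailHom v) := by
  simp only [trSymp, trPair, ← map_add]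
  congr 1
  simp only [dotProduct, Fin.sum_univ_succ, headHom_apply, tailHom_apply, Fin.tail]
  ring

theorem trSymp_add_right (u v w : SV F n) :
    trSymp p u (v + w) = trSymp p u v + trSymp p u w := by
  simp only [trSymp, ← map_add, Prod.fst_add, Prod.snd_add, add_dotProduct, dotProduct_add]
  congr 1
  ring

theorem trSymp_swap (u v : SV F n) : trSymp p u v = -trSymp p v u := by
  simp only [trSymp, ← map_neg, neg_sub]

/-- The trace-symplectic form as an additive map in its second argument. -/
noncomputable def trSympHom (p : ℕ) {F : Type*} [Field F] [Fintype F] [CharP F p] {n : ℕ}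
    (u : SV F n) : SV F n →+ ZMod p :=
  AddMonoidHom.mk' (trSymp p u) (trSymp_add_right u)

/-- The trace-symplectic dual as an additive subgroup. -/
noncomputable def sdualSubgroup (p : ℕ) {F : Type*} [Field F] [Fintype F] [CharP F p] {n : ℕ}
    (S : Set (SV F n)) : AddSubgroup (SV F n) :=
  (⨅ w ∈ S, (trSympHom p w).ker).copy (sdual p S) (by
    ext v
    simp only [sdual, Set.mem_ofPred_eq, SetLike.mem_coe, AddSubgroup.mem_iInf,
      AddMonoidHom.mem_ker, trSympHom, AddMonoidHom.mk'_apply]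
    exact forall₂_congr fun w _ => by rw [trSymp_swap, neg_eq_zero])

variable [Fact p.Prime]

theorem exists_eq_trPair (f : F × F →+ ZMod p) : ∃ a, ∀ b, f b = trPair p a b := by
  let := ZMod.algebra F p
  have key (g : F →+ ZMod p) : ∃ c, ∀ x, g x = Algebra.trace (ZMod p) F (c * x) := by
    have hnd := traceForm_nondegenerate (ZMod p) F
    refine ⟨((Algebra.traceForm (ZMod p) F).toDual hnd).symm (g.toZModLinearMap p), fun x => ?_⟩
    have := LinearMap.BilinForm.apply_toDual_symm_apply (hB := hnd) (g.toZModLinearMap p) x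
    rw [Algebra.traceForm_apply] at this
    exact this.symm
  obtain ⟨c, hc⟩ := key (f.comp (AddMonoidHom.inl F F))
  obtain ⟨e, he⟩ := key (f.comp (AddMonoidHom.inr F F))
  refine ⟨(-e, c), fun b => ?_⟩
  have hb : f b = f (b.1, 0) + f (0, b.2) := by rw [← map_add]; simp
  have h₁ := hc b.1
  have h₂ := he b.2
  simp only [AddMonoidHom.comp_apply, AddMonoidHom.inl_apply, AddMonoidHom.inr_apply] at h₁ h₂
  rw [hb, h₁, h₂, trPair, ← map_add]
  congr 1
  ring

/-- A subgroup whose dual has no nonzero word supported on the first coordinate projects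
onto the first coordinate pair. -/
theorem headHom_comp_subtype_surjective {D : AddSubgroup (SV F (n + 1))}
    (hD : ∀ v ∈ sdual p (D : Set (SV F (n + 1))), tailHom v = 0 → v = 0) :
    Function.Surjective (headHom.comp D.subtype) := by
  let := ZMod.algebra F p
  rw [← AddMonoidHom.range_eq_top]
  by_contra hne
  set H := (headHom.comp D.subtype).range
  have hlt : AddSubgroup.toZModSubmodule p H < ⊤ := by
    refine lt_top_iff_ne_top.2 fun h => hne ?_
    rw [eq_top_iff]
    intro x _
    have : x ∈ AddSubgroup.toZModSubmodule p H := h ▸ Submodule.mem_top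
    simpa using this
  obtain ⟨f, hf, hle⟩ := Submodule.exists_le_ker_of_lt_top _ hlt
  obtain ⟨a, ha⟩ := exists_eq_trPair f.toAddMonoidHom
  obtain ⟨u, hu, ht⟩ := exists_headHom_tailHom a (0 : SV F n)
  have hu0 : u = 0 := by
    refine hD u (fun w hw => ?_) ht
    have hw' : headHom w ∈ AddSubgroup.toZModSubmodule p H := by
      simpa using show headHom w ∈ H from ⟨⟨w, hw⟩, rfl⟩
    have h1 : f (headHom w) = 0 := hle hw'
    have h2 : trSymp p (0 : SV F n) (tailHom w) = 0 := by simp [trSymp]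
    rw [trSymp_eq_trPair_add, hu, ht, h2, add_zero, ← ha]
    exact h1
  refine hf (LinearMap.ext fun b => ?_)
  have h0 : a = 0 := by rw [← hu, hu0, map_zero]
  have := ha b
  rwa [h0, trPair_zero_left] at this

/-- The dual of a shortened subgroup is contained in the punctured dual. -/
theorem exists_mem_sdual_tailHom_eq {D : AddSubgroup (SV F (n + 1))}
    (hs : Function.Surjective (headHom.comp D.subtype)) {v : SV F n}
    (hv : v ∈ sdual p (tailHom '' {w : SV F (n + 1) | w ∈ D ∧ headHom w = 0})) :
    ∃ u ∈ sdual p (D : Set (SV F (n + 1))), tailHom u = v := by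
  let f : D →+ ZMod p := (trSympHom p v).comp (tailHom.comp D.subtype)
  have hker : (headHom.comp D.subtype).ker ≤ f.ker := fun w hw =>
    hv _ ⟨w, ⟨w.2, hw⟩, rfl⟩
  obtain ⟨a, ha⟩ := exists_eq_trPair (-((headHom.comp D.subtype).liftOfSurjective hs ⟨f, hker⟩))
  obtain ⟨u, hu, ht⟩ := exists_headHom_tailHom a v
  refine ⟨u, fun w hw => ?_, ht⟩
  have hl : (headHom.comp D.subtype).liftOfSurjective hs ⟨f, hker⟩ (headHom w) =
      trSymp p v (tailHom w) :=
    AddMonoidHom.liftOfRightInverse_comp_apply _ _ _ ⟨f, hker⟩ (⟨w, hw⟩ : D)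
  rw [trSymp_eq_trPair_add, hu, ht, ← ha, AddMonoidHom.neg_apply, hl, neg_add_cancel]

theorem card_shortened_mul {D : AddSubgroup (SV F (n + 1))}
    (hs : Function.Surjective (headHom.comp D.subtype)) :
    Nat.card (tailHom '' {w : SV F (n + 1) | w ∈ D ∧ headHom w = 0}) * Fintype.card F ^ 2 =
      Nat.card D := by
  have hinj : Set.InjOn (tailHom : SV F (n + 1) →+ SV F n)
      {w : SV F (n + 1) | w ∈ D ∧ headHom w = 0} := fun u hu v hv h =>
    eq_of_headHom_eq_of_tailHom_eq (hu.2.trans hv.2.symm) h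
  have hcard : Nat.card {w : SV F (n + 1) | w ∈ D ∧ headHom w = 0} =
      Nat.card (headHom.comp D.subtype).ker :=
    Nat.card_congr
      { toFun := fun w => ⟨⟨w.1, w.2.1⟩, w.2.2⟩
        invFun := fun w => ⟨w.1.1, w.1.2, w.2⟩
        left_inv := fun _ => rfl
        right_inv := fun _ => rfl }
  rw [Nat.card_image_of_injOn hinj, hcard,
    AddSubgroup.card_eq_card_quotient_mul_card_addSubgroup (headHom.comp D.subtype).ker,
    Nat.card_congr (QuotientAddGroup.quotientKerEquivOfSurjective _ hs).toEquiv,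
    Nat.card_prod, Nat.card_eq_fintype_card (α := F), mul_comm, sq]

theorem exists_punctured_subsystemCode {K R d : ℕ} (C : AddSubgroup (SV F (n + 1)))
    (h : IsSubsystemCode p K R d C) (hpure : PureTo p d C) (hd : 2 ≤ d) :
    ∃ (C' : AddSubgroup (SV F n)) (d' : ℕ), d - 1 ≤ d' ∧
      IsSubsystemCode p K (Fintype.card F * R) d' C' := by
  obtain ⟨hC, hK, hR, -⟩ := h
  let D : AddSubgroup (SV F (n + 1)) := C ⊓ sdualSubgroup p C
  have hDset : (D : Set (SV F (n + 1))) = (C : Set _) ∩ sdual p (C : Set _) := rfl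
  rw [PureTo, ← hDset] at hpure
  rw [← hDset] at hK hR
  have hCD : ∀ v ∈ C, v ∈ sdual p (D : Set (SV F (n + 1))) := fun v hv w hw => by
    rw [trSymp_swap, neg_eq_zero]
    exact hw.2 v hv
  have hD : ∀ v ∈ sdual p (D : Set (SV F (n + 1))), tailHom v = 0 → v = 0 := fun v hv ht => by
    by_contra h0
    have h1 := hpure.trans (swtSet_le hv h0)
    have h2 := swt_le_swt_tailHom_add_one v
    have h3 : swt (0 : SV F n) = 0 := by simp [swt]
    rw [ht, h3] at h2
    omega
  have hs := headHom_comp_subtype_surjective hD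
  have hinj : Set.InjOn (tailHom : SV F (n + 1) →+ SV F n) C := fun u hu v hv huv =>
    sub_eq_zero.1 (hD _ (hCD _ (C.sub_mem hu hv)) (by rw [map_sub, huv, sub_self]))
  let C' : AddSubgroup (SV F n) := C.map tailHom
  have hC'C : Nat.card C' = Nat.card C := Nat.card_image_of_injOn hinj
  have hD' : (C' : Set (SV F n)) ∩ sdual p (C' : Set (SV F n)) =
      tailHom '' {w : SV F (n + 1) | w ∈ D ∧ headHom w = 0} := by
    ext v
    constructor
    · rintro ⟨⟨c, hc, rfl⟩, hv⟩
      obtain ⟨u, hu, ht⟩ := exists_headHom_tailHom 0 (tailHom c)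
      have huC : u ∈ sdual p (C : Set (SV F (n + 1))) := fun w hw => by
        rw [trSymp_eq_trPair_add, hu, ht, trPair_zero_left, zero_add]
        exact hv _ ⟨w, hw, rfl⟩
      have hcu : c - u ∈ sdualSubgroup p (D : Set (SV F (n + 1))) :=
        AddSubgroup.sub_mem _ (hCD c hc) fun w hw => huC w hw.1
      have : c = u := sub_eq_zero.1 (hD _ hcu (by rw [map_sub, ht, sub_self]))
      subst this
      exact ⟨c, ⟨⟨hc, huC⟩, hu⟩, rfl⟩
    · rintro ⟨w, ⟨⟨hwC, hw⟩, h0⟩, rfl⟩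
      refine ⟨⟨w, hwC, rfl⟩, ?_⟩
      rintro _ ⟨c, hc, rfl⟩
      have := hw c hc
      rwa [trSymp_eq_trPair_add, h0, trPair_zero_left, zero_add] at this
  have hcard := card_shortened_mul hs
  rw [← hD'] at hcard
  have hdist : ∀ v ∈ sdual p ((C' : Set (SV F n)) ∩ sdual p (C' : Set (SV F n))), v ≠ 0 →
      d - 1 ≤ swt v := fun v hv h0 => by
    rw [hD'] at hv
    obtain ⟨u, hu, rfl⟩ := exists_mem_sdual_tailHom_eq hs hv
    have h1 := hpure.trans (swtSet_le hu fun h => h0 (by rw [h, map_zero]))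
    have h2 := swt_le_swt_tailHom_add_one u
    omega
  have hsub : (C' : Set (SV F n)) ⊆
      sdual p ((C' : Set (SV F n)) ∩ sdual p (C' : Set (SV F n))) := fun v hv w hw => by
    rw [trSymp_swap, neg_eq_zero]
    exact hw.2 v hv
  have hC' : C' ≠ ⊥ := fun h => hC <| by
    rw [← AddSubgroup.card_eq_one, ← hC'C, h, AddSubgroup.card_eq_one]
  have hq : 0 < Fintype.card F ^ 2 := pow_pos Fintype.card_pos 2
  refine ⟨C', _, ?_, hC', ?_, ?_, rfl⟩
  · split_ifs with heq
    · obtain ⟨v, hv, h0⟩ := C'.bot_or_exists_ne_zero.resolve_left hC'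
      exact le_swtSet ⟨v, hsub hv, h0⟩ hdist
    · obtain ⟨v, hv, hvC⟩ := Set.exists_of_ssubset (hsub.ssubset_of_ne (Ne.symm heq))
      exact le_swtSet ⟨v, ⟨hv, hvC⟩, fun h => hvC (h ▸ C'.zero_mem)⟩
        fun w hw => hdist w hw.1
  · refine Nat.eq_of_mul_eq_mul_right hq ?_
    rw [← pow_add, ← mul_add_one, ← hK, hC'C]
    change _ = K ^ 2 * (Nat.card C * Nat.card D)
    rw [← hcard]
    ring
  · rw [hC'C, ← hR]
    change _ = R ^ 2 * Nat.card D
    rw [← hcard]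
    ring

end Shortening

/-- Shortening: a pure `((n,K,R,d))_q` subsystem code with `n ≥ 2`, `d ≥ 2` gives a
`((n-1,K,qR,≥d-1))_q` subsystem code. -/
theorem stmt9 {p : ℕ} [Fact p.Prime] {F : Type} [Field F] [Fintype F] [CharP F p]
    {n K R d : ℕ} (C : AddSubgroup (SV F n))
    (h : IsSubsystemCode p K R d C) (hpure : PureTo p d C) (hn : 2 ≤ n) (hd : 2 ≤ d) :
    ∃ (C' : AddSubgroup (SV F (n - 1))) (d' : ℕ), d - 1 ≤ d' ∧
      IsSubsystemCode p K (Fintype.card F * R) d' C' := by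
  obtain ⟨m, rfl⟩ : ∃ m, n = m + 1 := ⟨n - 1, by omega⟩
  exact exists_punctured_subsystemCode C h hpure hd
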